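/- arXiv:1911.07027 — 4 statements merged into one kernel-verified Lean document; each statement's English description precedes it below -/
import Mathlib

section
/- Let π_E and π be two stationary policies. Then the total variation distance between their discounted state distributions satisfies D_TV(d_π, d_{π_E}) ≤ (γ/(1-γ)) · E_{s ∼ d_{π_E}}[ D_TV(π(·|s), π_E(·|s)) ]. -/
open scoped BigOperators
open MeasureTheory

/-- A probability vector on a finite type: nonnegative entries summing to 1. -/
def IsProbVec {X : Type*} [Fintype X] (p : X → ℝ) : Prop :=
  (∀ x, 0 ≤ p x) ∧ ∑ x, p x = 1

/-- A stationary policy assigns to each state a probability distribution over actions. -/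
def IsPolicy {S A : Type*} [Fintype A] (π : S → A → ℝ) : Prop :=
  ∀ s, IsProbVec (π s)

/-- A transition kernel assigns to each state-action pair a distribution over next states. -/
def IsKernel {S A : Type*} [Fintype S] (P : S → A → S → ℝ) : Prop :=
  ∀ s a, IsProbVec (P s a)

/-- `stateDist P π d0 t s = Pr(s_t = s ; π, d0)`. -/
noncomputable def stateDist {S A : Type*} [Fintype S] [Fintype A]
    (P : S → A → S → ℝ) (π : S → A → ℝ) (d0 : S → ℝ) : ℕ → S → ℝ
  | 0 => d0
  | t + 1 => fun s' => ∑ s, ∑ a, stateDist P π d0 t s * π s a * P s a s'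

/-- Discounted state distribution `d_π(s) = (1-γ) ∑_t γ^t Pr(s_t = s ; π, d0)`. -/
noncomputable def discStateDist {S A : Type*} [Fintype S] [Fintype A] (γ : ℝ)
    (P : S → A → S → ℝ) (π : S → A → ℝ) (d0 : S → ℝ) : S → ℝ :=
  fun s => (1 - γ) * ∑' t : ℕ, γ ^ t * stateDist P π d0 t s

/-- Discounted state-action distribution
`ρ_π(s,a) = (1-γ) ∑_t γ^t Pr(s_t = s, a_t = a ; π, d0)`. -/
noncomputable def discSADist {S A : Type*} [Fintype S] [Fintype A] (γ : ℝ)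
    (P : S → A → S → ℝ) (π : S → A → ℝ) (d0 : S → ℝ) : S × A → ℝ :=
  fun x => (1 - γ) * ∑' t : ℕ, γ ^ t * (stateDist P π d0 t x.1 * π x.1 x.2)

/-- Total variation distance `D_TV(P,Q) = (1/2) ∑_x |P(x) - Q(x)|`. -/
noncomputable def DTV {X : Type*} [Fintype X] (p q : X → ℝ) : ℝ :=
  (1 / 2) * ∑ x, |p x - q x|

/-- Policy value `V^π = E[∑_t γ^t r(s_t,a_t)]`. -/
noncomputable def policyValue {S A : Type*} [Fintype S] [Fintype A] (γ : ℝ)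
    (P : S → A → S → ℝ) (r : S → A → ℝ) (π : S → A → ℝ) (d0 : S → ℝ) : ℝ :=
  ∑' t : ℕ, γ ^ t * ∑ s, ∑ a, stateDist P π d0 t s * π s a * r s a

theorem stateDist_prob {S A : Type*} [Fintype S] [Fintype A]
    (P : S → A → S → ℝ) (hP : IsKernel P) (d0 : S → ℝ) (hd0 : IsProbVec d0)
    (π : S → A → ℝ) (hπ : IsPolicy π) (t : ℕ) : IsProbVec (stateDist P π d0 t) := by
  induction t with
  | zero => exact hd0
  | succ t ih =>
    refine ⟨fun s' => ?_, ?_⟩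
    · exact Finset.sum_nonneg fun s _ => Finset.sum_nonneg fun a _ =>
        mul_nonneg (mul_nonneg (ih.1 s) ((hπ s).1 a)) ((hP s a).1 s')
    · simp only [stateDist]
      rw [Finset.sum_comm]
      rw [← ih.2]
      refine Finset.sum_congr rfl fun s _ => ?_
      rw [Finset.sum_comm]
      simp only [← Finset.mul_sum, (hP s _).2, mul_one, (hπ s).2]

theorem stateDist_summable {S A : Type*} [Fintype S] [Fintype A]
    (γ : ℝ) (hγ0 : 0 < γ) (hγ1 : γ < 1)
    (P : S → A → S → ℝ) (hP : IsKernel P) (d0 : S → ℝ) (hd0 : IsProbVec d0)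
    (π : S → A → ℝ) (hπ : IsPolicy π) (s : S) :
    Summable fun t : ℕ => γ ^ t * stateDist P π d0 t s := by
  have hp := stateDist_prob P hP d0 hd0 π hπ
  refine Summable.of_nonneg_of_le (fun t => mul_nonneg (by positivity) ((hp t).1 s)) (fun t => ?_)
    (summable_geometric_of_lt_one hγ0.le hγ1)
  have h1 : stateDist P π d0 t s ≤ 1 := by
    rw [← (hp t).2]
    exact Finset.single_le_sum (fun i _ => (hp t).1 i) (Finset.mem_univ s)
  exact mul_le_of_le_one_right (by positivity) h1

theorem disc_flow {S A : Type*} [Fintype S] [Fintype A]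
    (γ : ℝ) (hγ0 : 0 < γ) (hγ1 : γ < 1)
    (P : S → A → S → ℝ) (hP : IsKernel P) (d0 : S → ℝ) (hd0 : IsProbVec d0)
    (π : S → A → ℝ) (hπ : IsPolicy π) (s' : S) :
    discStateDist γ P π d0 s' = (1 - γ) * d0 s' +
      γ * ∑ s, ∑ a, discStateDist γ P π d0 s * π s a * P s a s' := by
  have hs := stateDist_summable γ hγ0 hγ1 P hP d0 hd0 π hπ
  have h1 : HasSum (fun t : ℕ => γ ^ (t+1) * stateDist P π d0 (t+1) s')
      (γ * ∑ s, ∑ a, (∑' t : ℕ, γ ^ t * stateDist P π d0 t s) * (π s a * P s a s')) := by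
    have h2 : HasSum (fun t : ℕ => γ * ∑ s, ∑ a,
        (γ ^ t * stateDist P π d0 t s) * (π s a * P s a s'))
      (γ * ∑ s, ∑ a, (∑' t : ℕ, γ ^ t * stateDist P π d0 t s) * (π s a * P s a s')) :=
      (hasSum_sum fun s _ => hasSum_sum fun a _ => (hs s).hasSum.mul_right _).mul_left γ
    convert h2 using 2 with t
    simp only [stateDist, Finset.mul_sum]
    refine Finset.sum_congr rfl fun s _ => Finset.sum_congr rfl fun a _ => ?_
    ring
  have h3 := (hs s').tsum_eq_zero_add
  rw [h1.tsum_eq] at h3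
  unfold discStateDist
  rw [h3]
  simp only [pow_zero, one_mul, stateDist, mul_add, Finset.mul_sum]
  congr 1
  refine Finset.sum_congr rfl fun s _ => Finset.sum_congr rfl fun a _ => ?_
  ring

/-- Lemma 1: the total variation between discounted state distributions is
bounded by `γ/(1-γ)` times the expected (over `d_{π_E}`) per-state policy total variation. -/
theorem state_dist_discrepancy {S A : Type*} [Fintype S] [Fintype A]
    (γ : ℝ) (hγ0 : 0 < γ) (hγ1 : γ < 1)
    (P : S → A → S → ℝ) (hP : IsKernel P)
    (d0 : S → ℝ) (hd0 : IsProbVec d0)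
    (π πE : S → A → ℝ) (hπ : IsPolicy π) (hπE : IsPolicy πE) :
    DTV (discStateDist γ P π d0) (discStateDist γ P πE d0) ≤
      γ / (1 - γ) * ∑ s, discStateDist γ P πE d0 s * DTV (π s) (πE s) := by
  have hf := disc_flow γ hγ0 hγ1 P hP d0 hd0 π hπ
  have hfE := disc_flow γ hγ0 hγ1 P hP d0 hd0 πE hπE
  have hE0 : ∀ s, 0 ≤ discStateDist γ P πE d0 s := fun s =>
    mul_nonneg (by linarith) (tsum_nonneg fun t =>
      mul_nonneg (by positivity) ((stateDist_prob P hP d0 hd0 πE hπE t).1 s))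
  generalize discStateDist γ P π d0 = d at *
  generalize discStateDist γ P πE d0 = e at *
  have key : ∑ s', |d s' - e s'| ≤
      γ * (∑ s, |d s - e s| + ∑ s, e s * ∑ a, |π s a - πE s a|) := by
    calc ∑ s', |d s' - e s'|
        ≤ ∑ s', γ * ∑ s, ∑ a, (|d s - e s| * π s a + e s * |π s a - πE s a|) * P s a s' := by
          refine Finset.sum_le_sum fun s' _ => ?_
          have h : d s' - e s' = γ * ∑ s, ∑ a,
              ((d s - e s) * π s a + e s * (π s a - πE s a)) * P s a s' := by
            rw [hf s', hfE s', add_sub_add_left_eq_sub, ← mul_sub, ← Finset.sum_sub_distrib]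
            congr 1
            refine Finset.sum_congr rfl fun s _ => ?_
            rw [← Finset.sum_sub_distrib]
            refine Finset.sum_congr rfl fun a _ => ?_
            ring
          rw [h, abs_mul, abs_of_pos hγ0]
          refine mul_le_mul_of_nonneg_left ?_ hγ0.le
          refine (Finset.abs_sum_le_sum_abs _ _).trans (Finset.sum_le_sum fun s _ => ?_)
          refine (Finset.abs_sum_le_sum_abs _ _).trans (Finset.sum_le_sum fun a _ => ?_)
          rw [abs_mul, abs_of_nonneg ((hP s a).1 s')]
          refine mul_le_mul_of_nonneg_right ?_ ((hP s a).1 s')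
          refine (abs_add_le _ _).trans ?_
          rw [abs_mul, abs_mul, abs_of_nonneg ((hπ s).1 a), abs_of_nonneg (hE0 s)]
      _ = _ := by
          rw [← Finset.mul_sum, Finset.sum_comm, ← Finset.sum_add_distrib]
          congr 1
          refine Finset.sum_congr rfl fun s _ => ?_
          rw [Finset.sum_comm]
          simp only [← Finset.mul_sum, (hP s _).2, mul_one, Finset.sum_add_distrib, (hπ s).2]
  have h1 : 0 < 1 - γ := by linarith
  have e1 : ∑ s, e s * DTV (π s) (πE s) = (1/2) * ∑ s, e s * ∑ a, |π s a - πE s a| := by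
    rw [Finset.mul_sum]
    refine Finset.sum_congr rfl fun s _ => ?_
    unfold DTV
    ring
  rw [e1, div_mul_eq_mul_div, le_div_iff₀ h1]
  unfold DTV
  linarith
end

section
/- Let π_E and π be two stationary policies. Then the total variation distance between their discounted state-action distributions satisfies D_TV(ρ_π, ρ_{π_E}) ≤ (1/(1-γ)) · E_{s ∼ d_{π_E}}[ D_TV(π(·|s), π_E(·|s)) ]. -/
open scoped BigOperators
open MeasureTheory

theorem stateDist_hasSum {S A : Type*} [Fintype S] [Fintype A]
    (γ : ℝ) (hγ0 : 0 < γ) (hγ1 : γ < 1)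
    (P : S → A → S → ℝ) (hP : IsKernel P) (d0 : S → ℝ) (hd0 : IsProbVec d0)
    (π : S → A → ℝ) (hπ : IsPolicy π) (s : S) :
    Summable (fun t : ℕ => γ ^ t * stateDist P π d0 t s) := by
  refine Summable.of_nonneg_of_le (fun t => ?_) (fun t => ?_)
    (summable_geometric_of_lt_one hγ0.le hγ1)
  · exact mul_nonneg (by positivity) ((stateDist_prob P hP d0 hd0 π hπ t).1 s)
  · have h := stateDist_prob P hP d0 hd0 π hπ t
    have h1 : stateDist P π d0 t s ≤ 1 := by
      rw [← h.2]
      exact Finset.single_le_sum (fun i _ => h.1 i) (Finset.mem_univ s)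
    exact mul_le_of_le_one_right (by positivity) h1

theorem discSADist_eq {S A : Type*} [Fintype S] [Fintype A] (γ : ℝ)
    (P : S → A → S → ℝ) (d0 : S → ℝ) (π : S → A → ℝ) (s : S) (a : A) :
    discSADist γ P π d0 (s, a) = discStateDist γ P π d0 s * π s a := by
  simp only [discSADist, discStateDist, ← mul_assoc, tsum_mul_right]

theorem discStateDist_fix {S A : Type*} [Fintype S] [Fintype A]
    (γ : ℝ) (hγ0 : 0 < γ) (hγ1 : γ < 1)
    (P : S → A → S → ℝ) (hP : IsKernel P) (d0 : S → ℝ) (hd0 : IsProbVec d0)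
    (π : S → A → ℝ) (hπ : IsPolicy π) (s' : S) :
    discStateDist γ P π d0 s' = (1 - γ) * d0 s' +
      γ * ∑ x : S × A, discSADist γ P π d0 x * P x.1 x.2 s' := by
  have hs := stateDist_hasSum γ hγ0 hγ1 P hP d0 hd0 π hπ
  have h2 : HasSum (fun t : ℕ => γ ^ (t+1) * stateDist P π d0 (t+1) s')
      (γ * ∑ s, ∑ a, (∑' t : ℕ, γ ^ t * stateDist P π d0 t s) * (π s a * P s a s')) := by
    have := (hasSum_sum (s := Finset.univ) fun s _ => hasSum_sum (s := Finset.univ) fun a _ =>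
      (hs s).hasSum.mul_right (π s a * P s a s')).mul_left γ
    refine (congrArg (fun f : ℕ → ℝ => HasSum f _) (funext fun t => ?_)).mpr this
    simp only [stateDist, pow_succ, Finset.mul_sum]
    refine Finset.sum_congr rfl fun s _ => Finset.sum_congr rfl fun a _ => ?_
    ring
  rw [discStateDist, (hs s').tsum_eq_zero_add, h2.tsum_eq, Fintype.sum_prod_type]
  simp only [discSADist_eq, discStateDist, stateDist, Finset.mul_sum, pow_zero, one_mul, mul_add]
  congr 1
  refine Finset.sum_congr rfl fun s _ => Finset.sum_congr rfl fun a _ => ?_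
  ring

/-- Lemma 2: the total variation between discounted state-action distributions
is bounded by `1/(1-γ)` times the expected per-state policy total variation. -/
theorem sa_dist_discrepancy {S A : Type*} [Fintype S] [Fintype A]
    (γ : ℝ) (hγ0 : 0 < γ) (hγ1 : γ < 1)
    (P : S → A → S → ℝ) (hP : IsKernel P)
    (d0 : S → ℝ) (hd0 : IsProbVec d0)
    (π πE : S → A → ℝ) (hπ : IsPolicy π) (hπE : IsPolicy πE) :
    DTV (discSADist γ P π d0) (discSADist γ P πE d0) ≤
      1 / (1 - γ) * ∑ s, discStateDist γ P πE d0 s * DTV (π s) (πE s) := by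
  have hg : 0 < 1 - γ := by linarith
  set R := ∑ x : S × A, |discSADist γ P π d0 x - discSADist γ P πE d0 x| with hR
  set E := ∑ s, discStateDist γ P πE d0 s * ∑ a, |π s a - πE s a| with hE
  have he : ∀ s, 0 ≤ discStateDist γ P πE d0 s := fun s =>
    mul_nonneg hg.le (tsum_nonneg fun t =>
      mul_nonneg (by positivity) ((stateDist_prob P hP d0 hd0 πE hπE t).1 s))
  have h1 : R ≤ ∑ s, |discStateDist γ P π d0 s - discStateDist γ P πE d0 s| + E := by
    rw [hR, hE, Fintype.sum_prod_type, ← Finset.sum_add_distrib]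
    refine Finset.sum_le_sum fun s _ => ?_
    calc _ ≤ ∑ a, (|discStateDist γ P π d0 s - discStateDist γ P πE d0 s| * π s a +
            discStateDist γ P πE d0 s * |π s a - πE s a|) := by
          refine Finset.sum_le_sum fun a _ => ?_
          rw [discSADist_eq, discSADist_eq]
          have := abs_add_le ((discStateDist γ P π d0 s - discStateDist γ P πE d0 s) * π s a)
            (discStateDist γ P πE d0 s * (π s a - πE s a))
          rw [abs_mul, abs_mul, abs_of_nonneg (he s), abs_of_nonneg ((hπ s).1 a)] at this
          refine le_trans (le_of_eq ?_) this
          congr 1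
          ring
      _ = _ := by
          rw [Finset.sum_add_distrib, ← Finset.mul_sum, ← Finset.mul_sum, (hπ s).2, mul_one]
  have h2 : ∑ s, |discStateDist γ P π d0 s - discStateDist γ P πE d0 s| ≤ γ * R := by
    calc _ ≤ ∑ s', γ * ∑ x : S × A,
            |discSADist γ P π d0 x - discSADist γ P πE d0 x| * P x.1 x.2 s' := by
          refine Finset.sum_le_sum fun s' _ => ?_
          rw [discStateDist_fix γ hγ0 hγ1 P hP d0 hd0 π hπ s',
            discStateDist_fix γ hγ0 hγ1 P hP d0 hd0 πE hπE s', add_sub_add_left_eq_sub,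
            ← mul_sub, ← Finset.sum_sub_distrib, abs_mul, abs_of_pos hγ0]
          refine mul_le_mul_of_nonneg_left ?_ hγ0.le
          refine (Finset.abs_sum_le_sum_abs _ _).trans (Finset.sum_le_sum fun x _ => ?_)
          rw [← sub_mul, abs_mul, abs_of_nonneg ((hP x.1 x.2).1 s')]
      _ = _ := by
          rw [← Finset.mul_sum, Finset.sum_comm]
          simp only [← Finset.mul_sum, (hP _ _).2, mul_one, hR]
  have h3 : ∑ s, discStateDist γ P πE d0 s * DTV (π s) (πE s) = 1 / 2 * E := by
    rw [hE, Finset.mul_sum]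
    refine Finset.sum_congr rfl fun s _ => ?_
    rw [DTV]
    ring
  rw [h3, DTV, ← hR, one_div_mul_eq_div (1 - γ), le_div_iff₀ hg]
  nlinarith
end

section
/- Let π_E denote the expert policy and π_bc denote any (imitator's) stationary policy. Assume the reward function is bounded in absolute value by R_max. Then |V^{π_bc} − V^{π_E}| ≤ (√2 · R_max/(1-γ)²) · E_{s ∼ d_{π_E}}[ √( D_KL(π_bc(·|s), π_E(·|s)) ) ], where D_KL(P,Q) = ∑_x P(x) log(P(x)/Q(x)). -/
open scoped BigOperators
open MeasureTheory

/-- Kullback-Leibler divergence `D_KL(P,Q) = ∑_x P(x) log(P(x)/Q(x))`. -/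
noncomputable def KLdiv {X : Type*} [Fintype X] (p q : X → ℝ) : ℝ :=
  ∑ x, p x * Real.log (p x / q x)

lemma aux_log (u : ℝ) (hu : 0 < u) :
    (5 * u ^ 2 - 4 * u - 1) / (2 * u ^ 2 + 4 * u) ≤ Real.log u := by
  let h : ℝ → ℝ := fun u => Real.log u - (5 * u ^ 2 - 4 * u - 1) / (2 * u ^ 2 + 4 * u)
  have hd : ∀ x : ℝ, 0 < x → HasDerivAt h ((x - 1) ^ 3 / (x ^ 2 * (x + 2) ^ 2)) x := by
    intro x hx
    have h1 : HasDerivAt (fun u : ℝ => 5 * u ^ 2 - 4 * u - 1) (10 * x - 4) x := by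
      have := ((((hasDerivAt_id x).pow 2).const_mul 5).sub ((hasDerivAt_id x).const_mul 4)).sub_const 1
      refine this.congr_deriv ?_
      simp; ring
    have h2 : HasDerivAt (fun u : ℝ => 2 * u ^ 2 + 4 * u) (4 * x + 4) x := by
      have := ((((hasDerivAt_id x).pow 2).const_mul 2).add ((hasDerivAt_id x).const_mul 4))
      refine this.congr_deriv ?_
      simp; ring
    have hne : 2 * x ^ 2 + 4 * x ≠ 0 := by positivity
    refine ((Real.hasDerivAt_log hx.ne').sub (h1.div h2 hne)).congr_deriv ?_
    have e : 2 * x ^ 2 + 4 * x = 2 * x * (x + 2) := by ring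
    rw [e]
    field_simp
    ring
  have h1 : h 1 = 0 := by simp [h]; norm_num
  suffices 0 ≤ h u by simpa [h] using this
  rw [← h1]
  rcases le_total 1 u with hu1 | hu1
  · have : MonotoneOn h (Set.Ici 1) := by
      apply monotoneOn_of_deriv_nonneg (convex_Ici 1)
      · intro x hx
        exact (hd x (lt_of_lt_of_le one_pos hx)).continuousAt.continuousWithinAt
      · intro x hx
        rw [interior_Ici] at hx
        exact (hd x (lt_trans one_pos hx)).differentiableAt.differentiableWithinAt
      · intro x hx
        rw [interior_Ici] at hx
        have hx' : (1 : ℝ) < x := hx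
        rw [(hd x (lt_trans one_pos hx)).deriv]
        have : 0 < x - 1 := by linarith
        positivity
    exact this (Set.mem_Ici.2 le_rfl) hu1 hu1
  · have : AntitoneOn h (Set.Ioc 0 1) := by
      apply antitoneOn_of_deriv_nonpos (convex_Ioc 0 1)
      · intro x hx
        exact (hd x hx.1).continuousAt.continuousWithinAt
      · intro x hx
        rw [interior_Ioc] at hx
        exact (hd x hx.1).differentiableAt.differentiableWithinAt
      · intro x hx
        rw [interior_Ioc] at hx
        rw [(hd x hx.1).deriv]
        apply div_nonpos_of_nonpos_of_nonneg
        · have : 0 ≤ (1 - x) ^ 3 := pow_nonneg (by linarith [hx.2]) 3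
          nlinarith
        · positivity
    exact this ⟨hu, hu1⟩ ⟨one_pos, le_rfl⟩ hu1

lemma aux_kl_point (p q : ℝ) (hp : 0 ≤ p) (hq : 0 < q) :
    3 / 2 * (|p - q| ^ 2 / (p + 2 * q)) ≤ p * Real.log (p / q) - p + q := by
  rw [sq_abs]
  rcases hp.eq_or_lt with h | h
  · subst h
    simp only [zero_sub, zero_add, zero_mul, zero_div, sub_zero]
    have : (-q) ^ 2 / (2 * q) = q / 2 := by field_simp
    rw [this]; linarith
  · have := mul_le_mul_of_nonneg_left (aux_log (p / q) (by positivity)) hp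
    have e : p * ((5 * (p / q) ^ 2 - 4 * (p / q) - 1) / (2 * (p / q) ^ 2 + 4 * (p / q)))
        = 3 / 2 * ((p - q) ^ 2 / (p + 2 * q)) + p - q := by
      have e2 : 2 * (p / q) ^ 2 + 4 * (p / q) = 2 * p * (p + 2 * q) / q ^ 2 := by
        field_simp
        ring
      rw [e2]
      field_simp
      ring
    linarith

lemma aux_pinsker {X : Type*} [Fintype X] (p q : X → ℝ) (hp : IsProbVec p) (hq : IsProbVec q)
    (h : ∀ x, 0 < q x) : ∑ x, |p x - q x| ≤ Real.sqrt 2 * Real.sqrt (KLdiv p q) := by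
  rw [← Real.sqrt_mul (by norm_num)]
  apply Real.le_sqrt_of_sq_le
  have h1 := Finset.sq_sum_div_le_sum_sq_div Finset.univ (fun x => |p x - q x|)
    (g := fun x => p x + 2 * q x) (fun x _ => by have := hp.1 x; have := h x; positivity)
  have h2 : ∑ x, (p x + 2 * q x) = 3 := by
    rw [Finset.sum_add_distrib, ← Finset.mul_sum, hp.2, hq.2]; norm_num
  have h3 : ∑ x, 3 / 2 * (|p x - q x| ^ 2 / (p x + 2 * q x)) ≤ KLdiv p q := by
    calc _ ≤ ∑ x, (p x * Real.log (p x / q x) - p x + q x) :=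
          Finset.sum_le_sum fun x _ => aux_kl_point _ _ (hp.1 x) (h x)
      _ = KLdiv p q := by
          rw [Finset.sum_add_distrib, Finset.sum_sub_distrib, hp.2, hq.2, KLdiv]; ring
  rw [← Finset.mul_sum] at h3
  rw [h2] at h1
  linarith

lemma aux_stateDist {S A : Type*} [Fintype S] [Fintype A]
    (P : S → A → S → ℝ) (hP : IsKernel P) (π : S → A → ℝ) (hπ : IsPolicy π)
    (d0 : S → ℝ) (hd0 : IsProbVec d0) (t : ℕ) : IsProbVec (stateDist P π d0 t) := by
  induction t with
  | zero => exact hd0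
  | succ t ih =>
    constructor
    · intro s'
      exact Finset.sum_nonneg fun s _ => Finset.sum_nonneg fun a _ =>
        mul_nonneg (mul_nonneg (ih.1 s) ((hπ s).1 a)) ((hP s a).1 s')
    · simp only [stateDist]
      rw [Finset.sum_comm]
      simp_rw [Finset.sum_comm (s := (Finset.univ : Finset S)) (t := (Finset.univ : Finset A)),
        ← Finset.mul_sum]
      rw [Finset.sum_comm]
      simp [(hP _ _).2, ← Finset.mul_sum, (hπ _).2, ih.2]

/-- joint L1 difference -/
lemma aux_joint {S A : Type*} [Fintype S] [Fintype A] (p q : S → ℝ) (π μ : S → A → ℝ)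
    (hq : ∀ s, 0 ≤ q s) (hπ : IsPolicy π) :
    ∑ s, ∑ a, |p s * π s a - q s * μ s a| ≤
      ∑ s, |p s - q s| + ∑ s, q s * ∑ a, |π s a - μ s a| := by
  rw [← Finset.sum_add_distrib]
  refine Finset.sum_le_sum fun s _ => ?_
  calc _ ≤ ∑ a, (|p s - q s| * π s a + q s * |π s a - μ s a|) := by
        refine Finset.sum_le_sum fun a _ => ?_
        have e : p s * π s a - q s * μ s a
          = (p s - q s) * π s a + q s * (π s a - μ s a) := by ring
        rw [e]
        refine (abs_add_le _ _).trans ?_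
        rw [abs_mul, abs_mul, abs_of_nonneg ((hπ s).1 a), abs_of_nonneg (hq s)]
    _ = _ := by
        rw [Finset.sum_add_distrib, ← Finset.mul_sum, ← Finset.mul_sum, (hπ s).2, mul_one]

lemma aux_step {S A : Type*} [Fintype S] [Fintype A]
    (P : S → A → S → ℝ) (hP : IsKernel P) (f : S → A → ℝ) :
    ∑ s', |∑ s, ∑ a, f s a * P s a s'| ≤ ∑ s, ∑ a, |f s a| := by
  calc _ ≤ ∑ s', ∑ s, ∑ a, |f s a| * P s a s' := by
        refine Finset.sum_le_sum fun s' _ => ?_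
        refine (Finset.abs_sum_le_sum_abs _ _).trans (Finset.sum_le_sum fun s _ => ?_)
        refine (Finset.abs_sum_le_sum_abs _ _).trans (Finset.sum_le_sum fun a _ => ?_)
        rw [abs_mul, abs_of_nonneg ((hP s a).1 s')]
    _ = ∑ s, ∑ a, |f s a| := by
        rw [Finset.sum_comm]
        refine Finset.sum_congr rfl fun s _ => ?_
        rw [Finset.sum_comm]
        refine Finset.sum_congr rfl fun a _ => ?_
        rw [← Finset.mul_sum, (hP s a).2, mul_one]

lemma aux_summable (γ : ℝ) (hγ0 : 0 < γ) (hγ1 : γ < 1) (f : ℕ → ℝ) (C : ℝ)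
    (hf : ∀ t, |f t| ≤ C) : Summable fun t => γ ^ t * f t := by
  refine Summable.of_norm_bounded (g := fun t => γ ^ t * C)
    ((summable_geometric_of_lt_one hγ0.le hγ1).mul_right C) fun t => ?_
  rw [Real.norm_eq_abs, abs_mul, abs_of_nonneg (by positivity)]
  exact mul_le_mul_of_nonneg_left (hf t) (by positivity)

lemma aux_reward {S A : Type*} [Fintype S] [Fintype A] (f : S → A → ℝ)
    (r : S → A → ℝ) (Rmax : ℝ) (hr : ∀ s a, |r s a| ≤ Rmax) :
    |∑ s, ∑ a, f s a * r s a| ≤ Rmax * ∑ s, ∑ a, |f s a| := by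
  simp_rw [Finset.mul_sum]
  refine (Finset.abs_sum_le_sum_abs _ _).trans (Finset.sum_le_sum fun s _ => ?_)
  refine (Finset.abs_sum_le_sum_abs _ _).trans (Finset.sum_le_sum fun a _ => ?_)
  rw [abs_mul, mul_comm]
  exact mul_le_mul_of_nonneg_right (hr s a) (abs_nonneg _)

/-- KL-divergence version of the behavioral cloning value gap. -/
theorem bc_value_discrepancy_kl {S A : Type*} [Fintype S] [Fintype A]
    (γ : ℝ) (hγ0 : 0 < γ) (hγ1 : γ < 1)
    (P : S → A → S → ℝ) (hP : IsKernel P)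
    (d0 : S → ℝ) (hd0 : IsProbVec d0)
    (r : S → A → ℝ) (Rmax : ℝ) (hr : ∀ s a, |r s a| ≤ Rmax)
    (πbc πE : S → A → ℝ) (hπbc : IsPolicy πbc) (hπE : IsPolicy πE)
    (hsupp : ∀ s a, 0 < πE s a) :
    |policyValue γ P r πbc d0 - policyValue γ P r πE d0| ≤
      Real.sqrt 2 * Rmax / (1 - γ) ^ 2 *
        ∑ s, discStateDist γ P πE d0 s * Real.sqrt (KLdiv (πbc s) (πE s)) := by
  have hp := aux_stateDist P hP πbc hπbc d0 hd0
  have hq := aux_stateDist P hP πE hπE d0 hd0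
  set p := stateDist P πbc d0 with hpdef
  set q := stateDist P πE d0 with hqdef
  have hSne : Nonempty S := by
    by_contra hS
    rw [not_nonempty_iff] at hS
    have := hd0.2
    simp at this
  obtain ⟨s0⟩ := hSne
  have hAne : Nonempty A := by
    by_contra hS
    rw [not_nonempty_iff] at hS
    have := (hπE s0).2
    simp at this
  obtain ⟨a0⟩ := hAne
  have hR : 0 ≤ Rmax := (abs_nonneg _).trans (hr s0 a0)
  have h1γ : 0 < 1 - γ := by linarith
  let L : S → ℝ := fun s => ∑ a, |πbc s a - πE s a|
  have hL0 : ∀ s, 0 ≤ L s := fun s => Finset.sum_nonneg fun a _ => abs_nonneg _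
  let D : ℕ → ℝ := fun t => ∑ s, |p t s - q t s|
  let ε : ℕ → ℝ := fun t => ∑ s, q t s * L s
  let J : ℕ → ℝ := fun t => ∑ s, ∑ a, |p t s * πbc s a - q t s * πE s a|
  have hJ : ∀ t, J t ≤ D t + ε t := fun t => aux_joint _ _ _ _ (hq t).1 hπbc
  have hq1 : ∀ t s, q t s ≤ 1 := fun t s => by
    rw [← (hq t).2]
    exact Finset.single_le_sum (fun s _ => (hq t).1 s) (Finset.mem_univ s)
  have hDs : ∀ t, D (t + 1) ≤ D t + ε t := by
    intro t
    refine le_trans ?_ (hJ t)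
    refine le_trans (le_of_eq ?_) (aux_step P hP (fun s a => p t s * πbc s a - q t s * πE s a))
    refine Finset.sum_congr rfl fun s' _ => ?_
    simp only [hpdef, hqdef, stateDist, sub_mul, Finset.sum_sub_distrib]
  have hD0 : D 0 = 0 := by simp [D, hpdef, hqdef, stateDist]
  have hDn : ∀ t, 0 ≤ D t := fun t => Finset.sum_nonneg fun a _ => abs_nonneg _
  have hεn : ∀ t, 0 ≤ ε t := fun t =>
    Finset.sum_nonneg fun s _ => mul_nonneg ((hq t).1 s) (hL0 s)
  have hDb : ∀ t, |D t| ≤ 2 := by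
    intro t
    rw [abs_of_nonneg (hDn t)]
    calc D t ≤ ∑ s, (p t s + q t s) := by
          refine Finset.sum_le_sum fun s _ => ?_
          rw [abs_le]
          constructor <;> linarith [(hp t).1 s, (hq t).1 s]
      _ = 2 := by rw [Finset.sum_add_distrib, (hp t).2, (hq t).2]; norm_num
  have hεb : ∀ t, |ε t| ≤ ∑ s, L s := by
    intro t
    rw [abs_of_nonneg (hεn t)]
    exact Finset.sum_le_sum fun s _ => mul_le_of_le_one_left (hL0 s) (hq1 t s)
  have sD := aux_summable γ hγ0 hγ1 D _ hDb
  have sε := aux_summable γ hγ0 hγ1 ε _ hεb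
  have hrew : ∀ (π : S → A → ℝ) (_ : IsPolicy π) (d : S → ℝ) (_ : IsProbVec d),
      |∑ s, ∑ a, d s * π s a * r s a| ≤ Rmax := by
    intro π hπ d hd
    refine (aux_reward (fun s a => d s * π s a) r Rmax hr).trans (le_of_eq ?_)
    have : ∀ s a, |d s * π s a| = d s * π s a := fun s a =>
      abs_of_nonneg (mul_nonneg (hd.1 s) ((hπ s).1 a))
    simp only [this, ← Finset.mul_sum, (hπ _).2, mul_one, hd.2]
  have sp := aux_summable γ hγ0 hγ1 _ _ (fun t => hrew πbc hπbc (p t) (hp t))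
  have sq := aux_summable γ hγ0 hγ1 _ _ (fun t => hrew πE hπE (q t) (hq t))
  -- recursion
  have hW : ∑' t, γ ^ t * D t ≤ γ * (∑' t, γ ^ t * D t + ∑' t, γ ^ t * ε t) := by
    rw [← sD.tsum_add sε, ← tsum_mul_left]
    conv_lhs => rw [sD.tsum_eq_zero_add]
    rw [hD0, mul_zero, zero_add]
    refine Summable.tsum_le_tsum (fun t => ?_) ((summable_nat_add_iff 1).2 sD)
      ((sD.add sε).mul_left γ)
    have := mul_le_mul_of_nonneg_left (hDs t) (pow_nonneg hγ0.le (t + 1))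
    calc _ ≤ _ := this
      _ = _ := by ring
  have hWE : ∑' t, γ ^ t * D t + ∑' t, γ ^ t * ε t ≤ (∑' t, γ ^ t * ε t) / (1 - γ) := by
    rw [le_div_iff₀ h1γ]
    nlinarith
  have hV : |policyValue γ P r πbc d0 - policyValue γ P r πE d0| ≤
      Rmax * (∑' t, γ ^ t * D t + ∑' t, γ ^ t * ε t) := by
    unfold policyValue
    rw [← hpdef, ← hqdef, ← sp.tsum_sub sq, ← sD.tsum_add sε, ← tsum_mul_left, ← Real.norm_eq_abs]
    refine tsum_of_norm_bounded ((sD.add sε).mul_left Rmax).hasSum fun t => ?_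
    rw [← mul_sub, Real.norm_eq_abs, abs_mul, abs_of_nonneg (pow_nonneg hγ0.le t)]
    have h1 := aux_reward (fun s a => p t s * πbc s a - q t s * πE s a) r Rmax hr
    simp only [sub_mul, Finset.sum_sub_distrib] at h1
    have h2 := h1.trans (mul_le_mul_of_nonneg_left (hJ t) hR)
    have h3 := mul_le_mul_of_nonneg_left h2 (pow_nonneg hγ0.le t)
    calc _ ≤ _ := h3
      _ = _ := by ring
  have hE : ∑' t, γ ^ t * ε t = (∑ s, discStateDist γ P πE d0 s * L s) / (1 - γ) := by
    have sqs : ∀ s, Summable fun t => γ ^ t * q t s := fun s =>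
      aux_summable γ hγ0 hγ1 (fun t => q t s) 1
        (fun t => by rw [abs_of_nonneg ((hq t).1 s)]; exact hq1 t s)
    have e1 : ∀ t, γ ^ t * ε t = ∑ s, γ ^ t * q t s * L s := by
      intro t
      simp only [ε, Finset.mul_sum, mul_assoc]
    simp_rw [e1]
    rw [Summable.tsum_finsetSum (fun s _ => (sqs s).mul_right (L s)), Finset.sum_div]
    refine Finset.sum_congr rfl fun s _ => ?_
    rw [tsum_mul_right, discStateDist, ← hqdef]
    field_simp
  have hdn : ∀ s, 0 ≤ discStateDist γ P πE d0 s := fun s =>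
    mul_nonneg h1γ.le (tsum_nonneg fun t => mul_nonneg (pow_nonneg hγ0.le t) ((hq t).1 s))
  have hfin : ∑ s, discStateDist γ P πE d0 s * L s ≤
      Real.sqrt 2 * ∑ s, discStateDist γ P πE d0 s * Real.sqrt (KLdiv (πbc s) (πE s)) := by
    rw [Finset.mul_sum]
    refine Finset.sum_le_sum fun s _ => ?_
    have := mul_le_mul_of_nonneg_left
      (aux_pinsker (πbc s) (πE s) (hπbc s) (hπE s) (hsupp s)) (hdn s)
    calc _ ≤ _ := this
      _ = _ := by ring
  calc _ ≤ _ := hV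
    _ ≤ Rmax * ((∑' t, γ ^ t * ε t) / (1 - γ)) := mul_le_mul_of_nonneg_left hWE hR
    _ = Rmax / (1 - γ) ^ 2 * ∑ s, discStateDist γ P πE d0 s * L s := by
        rw [hE]; field_simp
    _ ≤ Rmax / (1 - γ) ^ 2 * (Real.sqrt 2 *
          ∑ s, discStateDist γ P πE d0 s * Real.sqrt (KLdiv (πbc s) (πE s))) :=
        mul_le_mul_of_nonneg_left hfin (by positivity)
    _ = _ := by ring
end

section
/- Let π_E denote the expert policy and π_GA denote any (GAIL imitator's) stationary policy. Assume the reward function is bounded in absolute value by R_max. Then |V^{π_E} − V^{π_GA}| ≤ (2√2 · R_max/(1-γ)) · √( D_JS(ρ_{π_GA}, ρ_{π_E}) ). -/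
open scoped BigOperators
open MeasureTheory

/-- Jensen-Shannon divergence `D_JS(P,Q) = (1/2)[D_KL(P,(P+Q)/2) + D_KL(Q,(P+Q)/2)]`. -/
noncomputable def JSdiv {X : Type*} [Fintype X] (p q : X → ℝ) : ℝ :=
  (1 / 2) * (KLdiv p (fun x => (p x + q x) / 2) + KLdiv q (fun x => (p x + q x) / 2))

lemma aux_log_s9 {x : ℝ} (h0 : 0 ≤ x) (h1 : x < 1) : 2 * x ≤ Real.log (1 + x) - Real.log (1 - x) := by
  have h := Real.hasSum_log_sub_log_of_abs_lt_one (x := x) (by rw [abs_of_nonneg h0]; exact h1)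
  have := h.summable.le_tsum 0 (fun k _ => by positivity)
  rw [h.tsum_eq] at this
  simpa using this

lemma aux_f0 {u : ℝ} (h0 : 0 ≤ u) (h1 : u ≤ 1) :
    u ^ 2 ≤ (1 + u) * Real.log (1 + u) + (1 - u) * Real.log (1 - u) := by
  let f : ℝ → ℝ := fun u => (1 + u) * Real.log (1 + u) + (1 - u) * Real.log (1 - u) - u ^ 2
  have hc : Continuous f := by
    have a := Real.continuous_mul_log.comp (continuous_const.add continuous_id : Continuous fun u : ℝ => 1 + u)
    have b := Real.continuous_mul_log.comp (continuous_const.sub continuous_id : Continuous fun u : ℝ => 1 - u)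
    exact (a.add b).sub (continuous_pow 2)
  have hd : ∀ x ∈ interior (Set.Icc (0:ℝ) 1),
      HasDerivAt f (Real.log (1 + x) - Real.log (1 - x) - 2 * x) x := by
    intro x hx
    rw [interior_Icc] at hx
    have p1 : HasDerivAt (fun u : ℝ => 1 + u) 1 x := (hasDerivAt_id x).const_add 1
    have p2 : HasDerivAt (fun u : ℝ => 1 - u) (-1) x := (hasDerivAt_id x).const_sub 1
    have a := (Real.hasDerivAt_mul_log (x := 1 + x) (by linarith [hx.1])).comp x p1
    have b := (Real.hasDerivAt_mul_log (x := 1 - x) (by linarith [hx.2])).comp x p2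
    have c := (a.add b).sub (hasDerivAt_pow 2 x)
    refine c.congr_deriv ?_
    norm_num
    ring
  have hm : MonotoneOn f (Set.Icc 0 1) := by
    refine monotoneOn_of_deriv_nonneg (convex_Icc 0 1) hc.continuousOn
      (fun x hx => (hd x hx).differentiableAt.differentiableWithinAt) ?_
    intro x hx
    rw [(hd x hx).deriv]
    rw [interior_Icc] at hx
    linarith [aux_log_s9 hx.1.le hx.2]
  have := hm (Set.left_mem_Icc.2 zero_le_one) ⟨h0, h1⟩ h0
  simp only [f] at this
  norm_num at this
  linarith

lemma aux_f {u : ℝ} (h0 : -1 ≤ u) (h1 : u ≤ 1) :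
    u ^ 2 ≤ (1 + u) * Real.log (1 + u) + (1 - u) * Real.log (1 - u) := by
  rcases le_total 0 u with h | h
  · exact aux_f0 h h1
  · have := aux_f0 (u := -u) (by linarith) (by linarith)
    rw [sub_neg_eq_add, ← sub_eq_add_neg, neg_sq] at this
    linarith

lemma aux_pt {p q : ℝ} (hp : 0 ≤ p) (hq : 0 ≤ q) :
    (p - q) ^ 2 / (p + q) ≤
      2 * (p * Real.log (p / ((p + q) / 2)) + q * Real.log (q / ((p + q) / 2))) := by
  rcases (add_nonneg hp hq).eq_or_lt with h | h
  · have z1 : p = 0 := by linarith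
    have z2 : q = 0 := by linarith
    simp [z1, z2]
  · have := aux_f (u := (p - q) / (p + q)) (by rw [le_div_iff₀ h]; linarith)
      (by rw [div_le_iff₀ h]; linarith)
    have e1 : 1 + (p - q) / (p + q) = p / ((p + q) / 2) := by field_simp; ring
    have e2 : 1 - (p - q) / (p + q) = q / ((p + q) / 2) := by field_simp; ring
    rw [e1, e2] at this
    have := mul_le_mul_of_nonneg_left this h.le
    have e3 : (p + q) * ((p - q) / (p + q)) ^ 2 = (p - q) ^ 2 / (p + q) := by field_simp
    rw [e3] at this
    refine this.trans (le_of_eq ?_)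
    generalize Real.log _ = a
    generalize Real.log _ = b
    field_simp

lemma aux_js {X : Type*} [Fintype X] {p q : X → ℝ} (hp : IsProbVec p) (hq : IsProbVec q) :
    ∑ x, |p x - q x| ≤ 2 * Real.sqrt 2 * Real.sqrt (JSdiv p q) := by
  have h1 : ∑ x, (p x - q x) ^ 2 / (p x + q x) ≤ 4 * JSdiv p q := by
    unfold JSdiv KLdiv
    rw [← Finset.sum_add_distrib, ← mul_assoc, Finset.mul_sum]
    refine Finset.sum_le_sum fun x _ => ?_
    have := aux_pt (hp.1 x) (hq.1 x)
    norm_num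
    exact this
  have h2 : (∑ x, |p x - q x|) ^ 2 ≤
      (∑ x, (p x - q x) ^ 2 / (p x + q x)) * ∑ x, (p x + q x) := by
    refine Finset.sum_sq_le_sum_mul_sum_of_sq_le_mul _ (fun x _ => ?_) (fun x _ => ?_) (fun x _ => ?_)
    · exact div_nonneg (sq_nonneg _) (add_nonneg (hp.1 x) (hq.1 x))
    · exact add_nonneg (hp.1 x) (hq.1 x)
    · have a := hp.1 x
      have b := hq.1 x
      rw [sq_abs]
      apply le_of_eq
      rcases (add_nonneg a b).eq_or_lt with h | h
      · have z1 : p x = 0 := by linarith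
        have z2 : q x = 0 := by linarith
        simp [z1, z2]
      · field_simp
  rw [Finset.sum_add_distrib, hp.2, hq.2] at h2
  have h3 : (∑ x, |p x - q x|) ^ 2 ≤ 8 * JSdiv p q := by linarith
  have h4 := Real.le_sqrt_of_sq_le h3
  have e : (8:ℝ) = 2 ^ 2 * 2 := by norm_num
  rw [Real.sqrt_mul (by norm_num), e, Real.sqrt_mul (by norm_num), Real.sqrt_sq (by norm_num)] at h4
  exact h4

section
variable {S A : Type*} [Fintype S] [Fintype A] {γ : ℝ} {P : S → A → S → ℝ} {d0 : S → ℝ}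
  {π : S → A → ℝ}

lemma aux_sd (hP : IsKernel P) (hd0 : IsProbVec d0) (hπ : IsPolicy π) (t : ℕ) :
    IsProbVec (stateDist P π d0 t) := by
  induction t with
  | zero => exact hd0
  | succ t ih =>
    refine ⟨fun s' => Finset.sum_nonneg fun s _ => Finset.sum_nonneg fun a _ =>
      mul_nonneg (mul_nonneg (ih.1 s) ((hπ s).1 a)) ((hP s a).1 s'), ?_⟩
    simp only [stateDist]
    rw [Finset.sum_comm]
    rw [← ih.2]
    refine Finset.sum_congr rfl fun s _ => ?_
    rw [Finset.sum_comm]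
    simp_rw [← Finset.mul_sum, (hP s _).2, mul_one]
    rw [← Finset.mul_sum, (hπ s).2, mul_one]

lemma aux_sa (hP : IsKernel P) (hd0 : IsProbVec d0) (hπ : IsPolicy π) (t : ℕ) :
    IsProbVec (fun x : S × A => stateDist P π d0 t x.1 * π x.1 x.2) := by
  have h := aux_sd hP hd0 hπ t
  refine ⟨fun x => mul_nonneg (h.1 _) ((hπ _).1 _), ?_⟩
  rw [Fintype.sum_prod_type]
  simp_rw [← Finset.mul_sum, (hπ _).2, mul_one]
  exact h.2

lemma aux_summable_s9 (hγ0 : 0 < γ) (hγ1 : γ < 1) (hP : IsKernel P) (hd0 : IsProbVec d0)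
    (hπ : IsPolicy π) (x : S × A) :
    Summable fun t : ℕ => γ ^ t * (stateDist P π d0 t x.1 * π x.1 x.2) := by
  refine Summable.of_nonneg_of_le (fun t => ?_) (fun t => ?_)
    (summable_geometric_of_lt_one hγ0.le hγ1)
  · exact mul_nonneg (by positivity) ((aux_sa hP hd0 hπ t).1 x)
  · have h := aux_sa hP hd0 hπ t
    refine mul_le_of_le_one_right (by positivity) ?_
    rw [← h.2]
    exact Finset.single_le_sum (f := fun x : S × A => stateDist P π d0 t x.1 * π x.1 x.2)
      (fun i _ => h.1 i) (Finset.mem_univ x)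

lemma aux_value (hγ0 : 0 < γ) (hγ1 : γ < 1) (hP : IsKernel P) (hd0 : IsProbVec d0)
    (hπ : IsPolicy π) (r : S → A → ℝ) :
    ∑ x : S × A, discSADist γ P π d0 x * r x.1 x.2 = (1 - γ) * policyValue γ P r π d0 := by
  unfold discSADist policyValue
  have : ∀ t : ℕ, γ ^ t * ∑ s, ∑ a, stateDist P π d0 t s * π s a * r s a =
      ∑ x : S × A, γ ^ t * (stateDist P π d0 t x.1 * π x.1 x.2) * r x.1 x.2 := by
    intro t
    rw [Fintype.sum_prod_type, Finset.mul_sum]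
    simp_rw [Finset.mul_sum, mul_assoc]
  simp_rw [this]
  rw [Summable.tsum_finsetSum fun x _ => (aux_summable_s9 hγ0 hγ1 hP hd0 hπ x).mul_right _,
    Finset.mul_sum]
  simp_rw [tsum_mul_right, mul_assoc]

lemma aux_rho (hγ0 : 0 < γ) (hγ1 : γ < 1) (hP : IsKernel P) (hd0 : IsProbVec d0)
    (hπ : IsPolicy π) : IsProbVec (discSADist γ P π d0) := by
  refine ⟨fun x => mul_nonneg (by linarith) (tsum_nonneg fun t =>
    mul_nonneg (by positivity) ((aux_sa hP hd0 hπ t).1 x)), ?_⟩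
  have h := aux_value hγ0 hγ1 hP hd0 hπ (fun _ _ => 1)
  simp only [mul_one] at h
  rw [h]
  unfold policyValue
  have : ∀ t : ℕ, ∑ s, ∑ a, stateDist P π d0 t s * π s a * 1 = 1 := by
    intro t
    have := (aux_sa hP hd0 hπ t).2
    rw [Fintype.sum_prod_type] at this
    simpa using this
  simp_rw [this, mul_one]
  rw [tsum_geometric_of_lt_one hγ0.le hγ1]
  exact mul_inv_cancel₀ (by linarith)

end

/-- Theorem 3: the GAIL value gap is bounded by `2√2 R_max/(1-γ)` times the
square root of the Jensen-Shannon divergence between state-action distributions. -/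
theorem gail_value_discrepancy {S A : Type*} [Fintype S] [Fintype A]
    (γ : ℝ) (hγ0 : 0 < γ) (hγ1 : γ < 1)
    (P : S → A → S → ℝ) (hP : IsKernel P)
    (d0 : S → ℝ) (hd0 : IsProbVec d0)
    (r : S → A → ℝ) (Rmax : ℝ) (hr : ∀ s a, |r s a| ≤ Rmax)
    (πGA πE : S → A → ℝ) (hπGA : IsPolicy πGA) (hπE : IsPolicy πE) :
    |policyValue γ P r πE d0 - policyValue γ P r πGA d0| ≤
      2 * Real.sqrt 2 * Rmax / (1 - γ) *
        Real.sqrt (JSdiv (discSADist γ P πGA d0) (discSADist γ P πE d0)) := by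
  have h1 : 0 < 1 - γ := by linarith
  have js := aux_js (aux_rho hγ0 hγ1 hP hd0 hπGA) (aux_rho hγ0 hγ1 hP hd0 hπE)
  have vG := aux_value hγ0 hγ1 hP hd0 hπGA r
  have vE := aux_value hγ0 hγ1 hP hd0 hπE r
  set p := discSADist γ P πGA d0
  set q := discSADist γ P πE d0
  have hR : 0 ≤ Rmax := by
    by_contra hn
    have hS : IsEmpty S := ⟨fun s => by
      obtain ⟨a⟩ : Nonempty A := by
        by_contra hA
        rw [not_nonempty_iff] at hA
        simpa using (hπE s).2
      exact hn ((abs_nonneg _).trans (hr s a))⟩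
    simpa using hd0.2
  have key : (1 - γ) * |policyValue γ P r πE d0 - policyValue γ P r πGA d0| ≤
      Rmax * ∑ x, |p x - q x| := by
    rw [← abs_of_pos h1, ← abs_mul, mul_sub, ← vG, ← vE, ← Finset.sum_sub_distrib,
      Finset.mul_sum]
    refine (Finset.abs_sum_le_sum_abs _ _).trans (Finset.sum_le_sum fun x _ => ?_)
    rw [← sub_mul, abs_mul, abs_sub_comm, mul_comm]
    exact mul_le_mul_of_nonneg_right (hr _ _) (abs_nonneg _)
  have k2 := key.trans (mul_le_mul_of_nonneg_left js hR)
  rw [div_mul_eq_mul_div, le_div_iff₀ h1]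
  linarith
end
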